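/- Let X and Y be independent nonnegative real-valued random variables on a probability space (Ω, P), and let f, g : [0,∞) → [0,∞) be nonincreasing functions such that P(X > y) ≤ f(y) and P(Y > y) ≤ g(y) for all y ≥ 0. Then for all x ≥ 0, P(X + Y > x) ≤ 1 − (f̄ ∗ ḡ)(x), where f̄(y) = 1 − max(min(f(y),1),0), ḡ(y) = 1 − max(min(g(y),1),0), and (f̄ ∗ ḡ)(x) = ∫_{[0,x]} ḡ(x − y) d f̄(y) is the Lebesgue–Stieltjes convolution with respect to the nondecreasing function f̄. -/

import Mathlib

open MeasureTheory ProbabilityTheory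

/-- If a nonnegative monotone function is dominated by the distribution function of `ν` on
`[0, ∞)`, then its Stieltjes measure of `[0, t]` is at most `ν (-∞, t]`. -/
lemma stieltjes_measure_Icc_le (ν : Measure ℝ) [IsProbabilityMeasure ν] {F : ℝ → ℝ}
    (hF : Monotone F) (h0 : ∀ y, 0 ≤ F y) (hle : ∀ y, 0 ≤ y → F y ≤ ν.real (Set.Iic y)) (t : ℝ) :
    hF.stieltjesFunction.measure (Set.Icc 0 t) ≤ ν (Set.Iic t) := by
  rcases lt_or_ge t 0 with ht | ht
  · simp [Set.Icc_eq_empty_of_lt ht]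
  have hleft : 0 ≤ Function.leftLim hF.stieltjesFunction 0 := by
    refine le_trans ?_ (hF.stieltjesFunction.mono.le_leftLim (show (-1 : ℝ) < 0 by norm_num))
    rw [hF.stieltjesFunction_eq]
    exact (h0 _).trans (hF.le_rightLim le_rfl)
  have hcdf : hF.stieltjesFunction t ≤ ν.real (Set.Iic t) := by
    rw [← cdf_eq_real, ← (cdf ν).iInf_Ioi_eq t]
    refine le_ciInf fun z => ?_
    rw [hF.stieltjesFunction_eq, cdf_eq_real]
    exact (hF.rightLim_le z.2).trans (hle z (ht.trans (le_of_lt z.2)))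
  rw [StieltjesFunction.measure_Icc, ← ofReal_measureReal (μ := ν)]
  exact ENNReal.ofReal_le_ofReal (by linarith)

/-- If `μ [0, t] ≤ ν₁ (-∞, t]` for all `t`, then convolving `μ` restricted to `[0, x]` with the
distribution function of `ν₂` is bounded by the distribution function of `ν₁ ∗ ν₂`. -/
lemma lintegral_Icc_measure_Iic_sub_le (μ ν₁ ν₂ : Measure ℝ) [SFinite μ] [SFinite ν₁] [SFinite ν₂]
    (h : ∀ t, μ (Set.Icc 0 t) ≤ ν₁ (Set.Iic t)) (x : ℝ) :
    ∫⁻ y in Set.Icc 0 x, ν₂ (Set.Iic (x - y)) ∂μ ≤ (ν₁.prod ν₂) {p | p.1 + p.2 ≤ x} := by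
  have hS : MeasurableSet {p : ℝ × ℝ | p.1 + p.2 ≤ x} :=
    measurableSet_le (measurable_fst.add measurable_snd) measurable_const
  calc ∫⁻ y in Set.Icc 0 x, ν₂ (Set.Iic (x - y)) ∂μ
      = ((μ.restrict (Set.Icc 0 x)).prod ν₂) {p | p.1 + p.2 ≤ x} := by
        rw [Measure.prod_apply hS]
        refine lintegral_congr fun y => congrArg ν₂ ?_
        ext v
        simp [le_sub_iff_add_le']
    _ ≤ (ν₁.prod ν₂) {p | p.1 + p.2 ≤ x} := by
        rw [Measure.prod_apply_symm hS, Measure.prod_apply_symm hS]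
        refine lintegral_mono fun v => ?_
        have hpre : (fun u : ℝ => (u, v)) ⁻¹' {p | p.1 + p.2 ≤ x} = Set.Iic (x - v) := by
          ext u
          simp [le_sub_iff_add_le]
        rw [hpre, Measure.restrict_apply measurableSet_Iic]
        refine (measure_mono (t := Set.Icc 0 (x - v)) ?_).trans (h (x - v))
        exact fun u hu => ⟨hu.2.1, hu.1⟩

/-- The truncated complement of a tail bound is a lower bound for the distribution function. -/
lemma one_sub_truncation_le_map_real_Iic {Ω : Type*} [MeasurableSpace Ω] (P : Measure Ω)
    [IsProbabilityMeasure P] {X : Ω → ℝ} (hX : Measurable X) {y b : ℝ}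
    (h : P {ω | y < X ω} ≤ ENNReal.ofReal b) :
    1 - max (min b 1) 0 ≤ (P.map X).real (Set.Iic y) := by
  have : IsProbabilityMeasure (P.map X) := Measure.isProbabilityMeasure_map hX.aemeasurable
  have htail : (P.map X).real (Set.Ioi y) ≤ max b 0 := by
    rw [map_measureReal_apply hX measurableSet_Ioi, ← ENNReal.toReal_ofReal']
    exact ENNReal.toReal_mono ENNReal.ofReal_ne_top h
  have hcompl := probReal_compl_eq_one_sub (μ := P.map X) (measurableSet_Iic (a := y))
  rw [Set.compl_Iic] at hcompl
  have hnonneg : 0 ≤ (P.map X).real (Set.Iic y) := measureReal_nonneg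
  grind

/-- Probabilistic convolution lemma: if `X, Y` are independent nonnegative
random variables with tail bounds `P(X > y) ≤ f(y)` and `P(Y > y) ≤ g(y)`
for nonincreasing `f, g`, then `P(X + Y > x) ≤ 1 − (f̄ ∗ ḡ)(x)`, where
`f̄(y) = 1 − [f(y)]₁`, `ḡ(y) = 1 − [g(y)]₁` (with `[·]₁ = max(min(·,1),0)`,
and `f̄` extended by `0` on negatives) and `(f̄ ∗ ḡ)(x) = ∫_{[0,x]} ḡ(x−y) d f̄(y)`
is the Lebesgue–Stieltjes convolution with respect to the nondecreasing
function `f̄`. -/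
theorem independent_tail_convolution_bound {Ω : Type*} [MeasurableSpace Ω]
    (P : Measure Ω) [IsProbabilityMeasure P]
    (X Y : Ω → ℝ) (hX : Measurable X) (hY : Measurable Y)
    (hXnn : ∀ ω, 0 ≤ X ω) (hYnn : ∀ ω, 0 ≤ Y ω)
    (hindep : IndepFun X Y P)
    (f g : ℝ → ℝ) (hf : AntitoneOn f (Set.Ici 0)) (hg : AntitoneOn g (Set.Ici 0))
    (hfnn : ∀ y : ℝ, 0 ≤ y → 0 ≤ f y) (hgnn : ∀ y : ℝ, 0 ≤ y → 0 ≤ g y)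
    (hXf : ∀ y : ℝ, 0 ≤ y → P {ω | y < X ω} ≤ ENNReal.ofReal (f y))
    (hYg : ∀ y : ℝ, 0 ≤ y → P {ω | y < Y ω} ≤ ENNReal.ofReal (g y))
    (fbar : ℝ → ℝ)
    (hfbar : ∀ y : ℝ, fbar y = if y < 0 then 0 else 1 - max (min (f y) 1) 0)
    (hmono : Monotone fbar) :
    ∀ x : ℝ, 0 ≤ x →
      P {ω | x < X ω + Y ω} ≤
        ENNReal.ofReal (1 - ∫ y in Set.Icc (0 : ℝ) x,
          (1 - max (min (g (x - y)) 1) 0) ∂hmono.stieltjesFunction.measure) := by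
  intro x hx
  have : IsProbabilityMeasure (P.map X) := Measure.isProbabilityMeasure_map hX.aemeasurable
  have : IsProbabilityMeasure (P.map Y) := Measure.isProbabilityMeasure_map hY.aemeasurable
  set μ := hmono.stieltjesFunction.measure
  by_cases hint : IntegrableOn (fun y => 1 - max (min (g (x - y)) 1) 0) (Set.Icc 0 x) μ
  swap
  · rw [integral_undef hint]
    simpa using prob_le_one
  have hμ : ∀ t, μ (Set.Icc 0 t) ≤ P.map X (Set.Iic t) := by
    refine stieltjes_measure_Icc_le (P.map X) hmono (fun y => ?_) fun y hy => ?_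
    · rw [hfbar]
      split_ifs
      · exact le_rfl
      · simp
    · rw [hfbar, if_neg hy.not_gt]
      exact one_sub_truncation_le_map_real_Iic P hX (hXf y hy)
  have hsum : MeasurableSet {ω | X ω + Y ω ≤ x} := measurableSet_le (hX.add hY) measurable_const
  have hconv : ENNReal.ofReal (∫ y in Set.Icc (0 : ℝ) x, (1 - max (min (g (x - y)) 1) 0) ∂μ) ≤
      P {ω | X ω + Y ω ≤ x} := by
    calc ENNReal.ofReal (∫ y in Set.Icc (0 : ℝ) x, (1 - max (min (g (x - y)) 1) 0) ∂μ)
        = ∫⁻ y in Set.Icc 0 x, ENNReal.ofReal (1 - max (min (g (x - y)) 1) 0) ∂μ :=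
          ofReal_integral_eq_lintegral_ofReal hint (ae_of_all _ fun y => by simp)
      _ ≤ ∫⁻ y in Set.Icc 0 x, P.map Y (Set.Iic (x - y)) ∂μ := by
          refine setLIntegral_mono' measurableSet_Icc fun y hy => ?_
          rw [← ofReal_measureReal (μ := P.map Y)]
          exact ENNReal.ofReal_le_ofReal
            (one_sub_truncation_le_map_real_Iic P hY (hYg _ (sub_nonneg.2 hy.2)))
      _ ≤ ((P.map X).prod (P.map Y)) {p | p.1 + p.2 ≤ x} :=
          lintegral_Icc_measure_Iic_sub_le μ _ _ hμ x
      _ = P {ω | X ω + Y ω ≤ x} := by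
          rw [← (indepFun_iff_map_prod_eq_prod_map_map hX.aemeasurable hY.aemeasurable).1 hindep,
            Measure.map_apply (hX.prodMk hY) (measurableSet_le (by fun_prop) measurable_const)]
          rfl
  have hcompl : {ω | x < X ω + Y ω} = {ω | X ω + Y ω ≤ x}ᶜ := by
    ext ω
    simp
  rw [hcompl, prob_compl_eq_one_sub hsum, ENNReal.ofReal_sub _ (integral_nonneg fun y => by simp),
    ENNReal.ofReal_one]
  exact tsub_le_tsub_left hconv 1
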